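/- Let d be a positive integer, K ≥ 2, and for each k ∈ {1,…,K} let z_k : ℝ^d → ℝ be L_k-Lipschitz with respect to the ℓ∞ norm, i.e. |z_k(a) − z_k(b)| ≤ L_k·‖a − b‖_∞ for all a, b ∈ ℝ^d. Fix x ∈ ℝ^d, a label y ∈ {1,…,K}, and ε ≥ 0. If max_{k ≠ y} z_k(x) − z_y(x) ≤ −(max_k L_k + L_y)·ε, then for every δ ∈ ℝ^d with ‖δ‖_∞ ≤ ε and every k ∈ {1,…,K}, z_k(x + δ) ≤ z_y(x + δ); that is, the classifier that predicts the label of largest logit is certified robust at x with radius ε. -/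

import Mathlib

/-- Proposition 1: if `x` is not a potentially misclassified sample, the
largest-logit classifier is certified robust at `x` with radius `ε`
(w.r.t. the ℓ∞ norm, which is the norm on `Fin d → ℝ`). -/
theorem certified_robustness
    (d K : ℕ) (hd : 0 < d) (hK : 2 ≤ K)
    (z : Fin K → (Fin d → ℝ) → ℝ) (L : Fin K → ℝ)
    (hLip : ∀ k (a b : Fin d → ℝ), |z k a - z k b| ≤ L k * ‖a - b‖)
    (x : Fin d → ℝ) (y : Fin K) (ε : ℝ) (hε : 0 ≤ ε)
    (hmargin : ∀ k, k ≠ y →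
      z k x - z y x ≤ -((Finset.univ.sup' ⟨y, Finset.mem_univ y⟩ L) + L y) * ε) :
    ∀ δ : Fin d → ℝ, ‖δ‖ ≤ ε → ∀ k, z k (x + δ) ≤ z y (x + δ) := by
  intro δ hδ k
  rcases eq_or_ne k y with rfl | hk
  · exact le_rfl
  have : Nonempty (Fin d) := ⟨⟨0, hd⟩⟩
  have hL : ∀ j, 0 ≤ L j := fun j => by
    have h := (abs_nonneg _).trans (hLip j (fun _ => 1) 0)
    rwa [sub_zero, pi_norm_const, norm_one, mul_one] at h
  have hclose : ∀ j, |z j (x + δ) - z j x| ≤ L j * ε := fun j => by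
    have h := hLip j (x + δ) x
    rw [add_sub_cancel_left] at h
    exact h.trans (mul_le_mul_of_nonneg_left hδ (hL j))
  have hsup : L k * ε ≤ Finset.univ.sup' ⟨y, Finset.mem_univ y⟩ L * ε :=
    mul_le_mul_of_nonneg_right (Finset.le_sup' L (Finset.mem_univ k)) hε
  have hk_le := (abs_le.mp (hclose k)).2
  have hy_ge := (abs_le.mp (hclose y)).1
  linarith [hmargin k hk]
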